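/- arXiv:1603.08747 — 10 statements merged into one kernel-verified Lean document; each statement's English description precedes it below -/
import Mathlib

section
/- Let J ⊆ ℝ be an open interval and g, h : J → ℝ with g differentiable, h differentiable, and g(Y) ≠ 0 on J. Suppose the Chiellini condition (h/g)'(Y) = p·g(Y) holds on J for some constant p, and let c ∈ ℝ satisfy p·c² + c + 1 = 0. Then the function z(Y) := c·h(Y)/g(Y) satisfies the Abel equation of the second kind z(Y)·z'(Y) + g(Y)·z(Y) + h(Y) = 0 for all Y ∈ J. -/
open Set

/-- If `g, h` are differentiable on an open interval with `g` nonvanishing,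
the Chiellini condition `(h/g)' = p·g` holds for a constant `p`, and `c` satisfies
`p·c² + c + 1 = 0`, then `z := c·h/g` satisfies the Abel equation of the second kind
`z·z' + g·z + h = 0`. -/
theorem chiellini_gives_abel_solution (a b p c : ℝ) (g h : ℝ → ℝ)
    (hg : ∀ Y ∈ Ioo a b, DifferentiableAt ℝ g Y)
    (hh : ∀ Y ∈ Ioo a b, DifferentiableAt ℝ h Y)
    (hg0 : ∀ Y ∈ Ioo a b, g Y ≠ 0)
    (hch : ∀ Y ∈ Ioo a b, deriv (fun y => h y / g y) Y = p * g Y)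
    (hpc : p * c ^ 2 + c + 1 = 0) :
    ∀ Y ∈ Ioo a b,
      (c * h Y / g Y) * deriv (fun y => c * h y / g y) Y +
        g Y * (c * h Y / g Y) + h Y = 0 := by
  intro Y hY
  have hz : deriv (fun y => c * h y / g y) Y = c * (p * g Y) := by
    simp only [mul_div_assoc]
    rw [deriv_const_mul_field, hch Y hY]
  have hgY := hg0 Y hY
  rw [hz]
  field_simp
  linear_combination h Y * hpc
end

section
/- Let J ⊆ ℝ be an open interval and g, h : J → ℝ with g differentiable, h differentiable, g(Y) ≠ 0 on J, and suppose the Chiellini condition with p = −2 holds: (h/g)'(Y) = −2·g(Y) on J. Let I ⊆ ℝ be an open interval and Y : I → ℝ a differentiable function with values in J satisfying the first-order equation Y'(t) = h(Y(t))/g(Y(t)) for all t ∈ I. Then Y is twice differentiable and satisfies both the Liénard equation Y''(t) + g(Y(t))·Y'(t) + h(Y(t)) = 0 and the undamped equation Y''(t) + 2·h(Y(t)) = 0 for all t ∈ I. -/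
open Set

/-- Under the Chiellini condition with `p = −2`, any solution of the
first-order equation `Y' = h(Y)/g(Y)` is twice differentiable and satisfies both the
Liénard equation `Y'' + g(Y)·Y' + h(Y) = 0` and the undamped equation `Y'' + 2·h(Y) = 0`. -/
theorem chiellini_first_order_solves_lienard (aJ bJ aI bI : ℝ) (g h Y : ℝ → ℝ)
    (hg : ∀ y ∈ Ioo aJ bJ, DifferentiableAt ℝ g y)
    (hh : ∀ y ∈ Ioo aJ bJ, DifferentiableAt ℝ h y)
    (hg0 : ∀ y ∈ Ioo aJ bJ, g y ≠ 0)
    (hch : ∀ y ∈ Ioo aJ bJ, deriv (fun u => h u / g u) y = -2 * g y)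
    (hYmem : ∀ t ∈ Ioo aI bI, Y t ∈ Ioo aJ bJ)
    (hY : ∀ t ∈ Ioo aI bI, HasDerivAt Y (h (Y t) / g (Y t)) t) :
    ∀ t ∈ Ioo aI bI,
      DifferentiableAt ℝ (deriv Y) t ∧
      deriv (deriv Y) t + g (Y t) * deriv Y t + h (Y t) = 0 ∧
      deriv (deriv Y) t + 2 * h (Y t) = 0 := by
  intro t ht
  have hgt : g (Y t) ≠ 0 := hg0 _ (hYmem t ht)
  have hz : HasDerivAt (fun u => h u / g u) (-2 * g (Y t)) (Y t) :=
    hch _ (hYmem t ht) ▸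
      ((hh _ (hYmem t ht)).fun_div (hg _ (hYmem t ht)) hgt).hasDerivAt
  have heq : deriv Y =ᶠ[nhds t] fun s => h (Y s) / g (Y s) := by
    filter_upwards [isOpen_Ioo.mem_nhds ht] with s hs using (hY s hs).deriv
  have hd : HasDerivAt (deriv Y) (-2 * g (Y t) * (h (Y t) / g (Y t))) t :=
    (hz.comp t (hY t ht)).congr_of_eventuallyEq heq
  refine ⟨hd.differentiableAt, ?_, ?_⟩
  · rw [hd.deriv, (hY t ht).deriv]
    field_simp
    ring
  · rw [hd.deriv]
    field_simp
    ring
end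

section
/- Let J ⊆ ℝ be an open interval, h : J → ℝ differentiable, H : J → ℝ with H' = h, and c ∈ ℝ such that c − 4·H(y) > 0 for all y ∈ J. Define g(y) := h(y)/√(c − 4·H(y)). Let I ⊆ ℝ be an open interval and Y : I → ℝ a differentiable function with values in J satisfying Y'(t) = √(c − 4·H(Y(t))) for all t ∈ I. Then Y is twice differentiable on I and satisfies both the Liénard equation Y''(t) + g(Y(t))·Y'(t) + h(Y(t)) = 0 and the undamped equation Y''(t) + 2·h(Y(t)) = 0 for all t ∈ I. -/
open Set

/-- With `H' = h`, `c − 4H > 0` on `J` and `g := h/√(c − 4H)`, any solution of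
`Y' = √(c − 4·H(Y))` is twice differentiable and satisfies both the Liénard equation
`Y'' + g(Y)·Y' + h(Y) = 0` and the undamped equation `Y'' + 2·h(Y) = 0`. -/
theorem first_order_reduction_solves_lienard (aJ bJ aI bI c : ℝ) (h H g Y : ℝ → ℝ)
    (hh : ∀ y ∈ Ioo aJ bJ, DifferentiableAt ℝ h y)
    (hH : ∀ y ∈ Ioo aJ bJ, HasDerivAt H (h y) y)
    (hpos : ∀ y ∈ Ioo aJ bJ, 0 < c - 4 * H y)
    (hgdef : ∀ y ∈ Ioo aJ bJ, g y = h y / Real.sqrt (c - 4 * H y))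
    (hYmem : ∀ t ∈ Ioo aI bI, Y t ∈ Ioo aJ bJ)
    (hY : ∀ t ∈ Ioo aI bI, HasDerivAt Y (Real.sqrt (c - 4 * H (Y t))) t) :
    ∀ t ∈ Ioo aI bI,
      DifferentiableAt ℝ (deriv Y) t ∧
      deriv (deriv Y) t + g (Y t) * deriv Y t + h (Y t) = 0 ∧
      deriv (deriv Y) t + 2 * h (Y t) = 0 := by
  intro t ht
  have hp := hpos _ (hYmem t ht)
  have hs : Real.sqrt (c - 4 * H (Y t)) ≠ 0 := (Real.sqrt_pos.2 hp).ne'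
  have hHY : HasDerivAt (fun s => H (Y s)) (h (Y t) * Real.sqrt (c - 4 * H (Y t))) t :=
    (hH _ (hYmem t ht)).comp t (hY t ht)
  have hsqrt : HasDerivAt (fun s => Real.sqrt (c - 4 * H (Y s))) (-(2 * h (Y t))) t := by
    convert ((hHY.const_mul 4).const_sub c).sqrt hp.ne' using 1
    field_simp
    ring
  have heq : deriv Y =ᶠ[nhds t] fun s => Real.sqrt (c - 4 * H (Y s)) := by
    filter_upwards [Ioo_mem_nhds ht.1 ht.2] with s hs using (hY s hs).deriv
  have hY'' : HasDerivAt (deriv Y) (-(2 * h (Y t))) t := hsqrt.congr_of_eventuallyEq heq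
  refine ⟨hY''.differentiableAt, ?_, ?_⟩
  · rw [hY''.deriv, (hY t ht).deriv, hgdef _ (hYmem t ht), div_mul_cancel₀ _ hs]
    ring
  · rw [hY''.deriv]
    ring
end

section
/- Let c > 0, set a := √(c/3), λ := (3/2)·a, η := a³/2, and fix t₀ ∈ ℝ. Then the function y(t) := √(1/(t − t₀)² + a), defined for t ≠ t₀, is twice differentiable and satisfies the undamped Ermakov–Painlevé II equation with ε = −1: y''(t) + 2·(λ·y(t) − y(t)³ − η/y(t)³) = 0 for all t ≠ t₀. -/
open Set

/-- Derivative of `s ↦ √(1 / (s - t₀)² + a)` away from the pole `t₀`. -/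
theorem hasDerivAt_sqrt_one_div_sq_add {t₀ a t : ℝ} (ha : 0 < a) (ht : t ≠ t₀) :
    HasDerivAt (fun s => Real.sqrt (1 / (s - t₀) ^ 2 + a))
      (-1 / ((t - t₀) ^ 3 * Real.sqrt (1 / (t - t₀) ^ 2 + a))) t := by
  have hx : t - t₀ ≠ 0 := sub_ne_zero.mpr ht
  have hu : 0 < 1 / (t - t₀) ^ 2 + a := by positivity
  have hy : Real.sqrt (1 / (t - t₀) ^ 2 + a) ≠ 0 := (Real.sqrt_pos.mpr hu).ne'
  have hsq : HasDerivAt (fun s => (s - t₀) ^ 2) (2 * (t - t₀)) t := by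
    simpa using ((hasDerivAt_id t).sub_const t₀).fun_pow 2
  have h : HasDerivAt (fun s => 1 / (s - t₀) ^ 2 + a)
      (-(2 * (t - t₀)) / ((t - t₀) ^ 2) ^ 2) t := by
    simpa only [one_div] using (hsq.fun_inv (pow_ne_zero 2 hx)).add_const a
  convert h.sqrt hu.ne' using 1
  generalize Real.sqrt (1 / (t - t₀) ^ 2 + a) = y at hy
  field_simp

/-- The function `y = √(1 / (s - t₀)² + a)` satisfies `y'' = 2y³ - 3ay + a³/y³`, where the
first derivative is written in closed form. -/
theorem hasDerivAt_deriv_sqrt_one_div_sq_add {t₀ a t : ℝ} (ha : 0 < a) (ht : t ≠ t₀) :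
    HasDerivAt (deriv (fun s => Real.sqrt (1 / (s - t₀) ^ 2 + a)))
      (2 * Real.sqrt (1 / (t - t₀) ^ 2 + a) ^ 3 - 3 * a * Real.sqrt (1 / (t - t₀) ^ 2 + a)
        + a ^ 3 / Real.sqrt (1 / (t - t₀) ^ 2 + a) ^ 3) t := by
  have hx : t - t₀ ≠ 0 := sub_ne_zero.mpr ht
  have hu : 0 < 1 / (t - t₀) ^ 2 + a := by positivity
  have hy : Real.sqrt (1 / (t - t₀) ^ 2 + a) ≠ 0 := (Real.sqrt_pos.mpr hu).ne'
  have hyy : Real.sqrt (1 / (t - t₀) ^ 2 + a) ^ 2 = 1 / (t - t₀) ^ 2 + a := Real.sq_sqrt hu.le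
  have heq : deriv (fun s => Real.sqrt (1 / (s - t₀) ^ 2 + a)) =ᶠ[nhds t]
      fun s => -1 / ((s - t₀) ^ 3 * Real.sqrt (1 / (s - t₀) ^ 2 + a)) := by
    filter_upwards [isOpen_ne.mem_nhds ht] with s hs
    exact (hasDerivAt_sqrt_one_div_sq_add ha hs).deriv
  refine HasDerivAt.congr_of_eventuallyEq ?_ heq
  have hcube : HasDerivAt (fun s => (s - t₀) ^ 3) (3 * (t - t₀) ^ 2) t := by
    simpa using ((hasDerivAt_id t).sub_const t₀).fun_pow 3
  have h := (hasDerivAt_const t (-1 : ℝ)).div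
    (hcube.mul (hasDerivAt_sqrt_one_div_sq_add ha ht)) (mul_ne_zero (pow_ne_zero 3 hx) hy)
  refine h.congr_deriv ?_
  simp only [Pi.mul_apply]
  generalize Real.sqrt (1 / (t - t₀) ^ 2 + a) = y at hy hyy
  obtain rfl : a = y ^ 2 - 1 / (t - t₀) ^ 2 := by linarith
  field_simp
  ring

/-- For `c > 0`, `a = √(c/3)`, `λ = (3/2)·a`, `η = a³/2`, the function
`y(t) = √(1/(t − t₀)² + a)` is twice differentiable for `t ≠ t₀` and satisfies the
undamped Ermakov–Painlevé II equation with `ε = −1`: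
`y'' + 2·(λ·y − y³ − η/y³) = 0`. -/
theorem explicit_solution_epII_eps_neg_one (c t₀ a lam eta : ℝ)
    (hc : 0 < c)
    (ha : a = Real.sqrt (c / 3))
    (hlam : lam = (3 / 2) * a)
    (heta : eta = a ^ 3 / 2) :
    ∀ t : ℝ, t ≠ t₀ →
      DifferentiableAt ℝ (deriv (fun s => Real.sqrt (1 / (s - t₀) ^ 2 + a))) t ∧
      deriv (deriv (fun s => Real.sqrt (1 / (s - t₀) ^ 2 + a))) t +
        2 * (lam * Real.sqrt (1 / (t - t₀) ^ 2 + a)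
            - (Real.sqrt (1 / (t - t₀) ^ 2 + a)) ^ 3
            - eta / (Real.sqrt (1 / (t - t₀) ^ 2 + a)) ^ 3) = 0 := by
  intro t ht
  have ha_pos : 0 < a := ha ▸ Real.sqrt_pos.mpr (by positivity)
  have h := hasDerivAt_deriv_sqrt_one_div_sq_add ha_pos ht
  refine ⟨h.differentiableAt, ?_⟩
  rw [h.deriv, hlam, heta]
  ring
end

section
/- Let c > 0, a := √(c/3), λ := (3/2)·a, η := a³/2, and t₀ ∈ ℝ. Define y(t) := √(1/(t − t₀)² + a) for t < t₀, and define g(u) := (λ·u − u³ − η·u⁻³)/√(c + u⁴ − 2·λ·u² − 2·η·u⁻²) wherever the expression under the square root is positive. Then for every t < t₀ the quantity c + y(t)⁴ − 2λ·y(t)² − 2η·y(t)⁻² is positive, y'(t) = √(c + y(t)⁴ − 2λ·y(t)² − 2η·y(t)⁻²), and y satisfies the damped Ermakov–Painlevé II equation y''(t) + g(y(t))·y'(t) + λ·y(t) − y(t)³ − η/y(t)³ = 0. -/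
open Set

lemma hasDerivAt_inv_const_sub {t₀ t : ℝ} (ht : t < t₀) :
    HasDerivAt (fun s => (t₀ - s)⁻¹) ((t₀ - t)⁻¹ ^ 2) t := by
  have h := ((hasDerivAt_id t).const_sub t₀).inv (sub_pos.2 ht).ne'
  refine h.congr_deriv ?_
  simp [inv_pow]

lemma hasDerivAt_sqrt_sq_add {w : ℝ → ℝ} {w' a t : ℝ} (hw : HasDerivAt w w' t)
    (h : w t ^ 2 + a ≠ 0) :
    HasDerivAt (fun s => √(w s ^ 2 + a)) (w t * w' / √(w t ^ 2 + a)) t := by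
  refine (((hw.pow 2).add_const a).sqrt h).congr_deriv ?_
  simp only [Pi.pow_apply]
  push_cast
  rw [← mul_div_mul_left _ _ (two_ne_zero' ℝ)]
  ring

/-- The radicand is `(u² - a)³ / u²`; it is a square when `u² - a` is. -/
lemma radicand_eq_sq {a u w : ℝ} (hu : u ≠ 0) (h : u ^ 2 = w ^ 2 + a) :
    3 * a ^ 2 + u ^ 4 - 2 * (3 / 2 * a) * u ^ 2 - 2 * (a ^ 3 / 2) / u ^ 2 =
      (w ^ 3 / u) ^ 2 := by
  have h' : a = u ^ 2 - w ^ 2 := by linarith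
  subst h'
  field_simp
  ring

/-- For `c > 0`, `a = √(c/3)`, `λ = (3/2)·a`, `η = a³/2`, the function
`y(t) = √(1/(t − t₀)² + a)` on `t < t₀` has positive radicand
`c + y⁴ − 2λy² − 2η/y²`, satisfies `y' = √(c + y⁴ − 2λy² − 2η/y²)`, and solves the damped
Ermakov–Painlevé II equation `y'' + g(y)·y' + λ·y − y³ − η/y³ = 0`, where
`g(u) = (λ·u − u³ − η·u⁻³)/√(c + u⁴ − 2λu² − 2ηu⁻²)`. -/
theorem explicit_solution_damped_epII (c t₀ a lam eta : ℝ)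
    (hc : 0 < c)
    (ha : a = Real.sqrt (c / 3))
    (hlam : lam = (3 / 2) * a)
    (heta : eta = a ^ 3 / 2)
    (y g : ℝ → ℝ)
    (hydef : ∀ t < t₀, y t = Real.sqrt (1 / (t - t₀) ^ 2 + a))
    (hgdef : ∀ u : ℝ, 0 < c + u ^ 4 - 2 * lam * u ^ 2 - 2 * eta / u ^ 2 →
      g u = (lam * u - u ^ 3 - eta / u ^ 3) /
        Real.sqrt (c + u ^ 4 - 2 * lam * u ^ 2 - 2 * eta / u ^ 2)) :
    ∀ t < t₀,
      0 < c + (y t) ^ 4 - 2 * lam * (y t) ^ 2 - 2 * eta / (y t) ^ 2 ∧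
      HasDerivAt y
        (Real.sqrt (c + (y t) ^ 4 - 2 * lam * (y t) ^ 2 - 2 * eta / (y t) ^ 2)) t ∧
      deriv (deriv y) t + g (y t) * deriv y t +
        (lam * y t - (y t) ^ 3 - eta / (y t) ^ 3) = 0 := by
  have ha0 : 0 < a := ha ▸ Real.sqrt_pos.2 (by positivity)
  have hca : c = 3 * a ^ 2 := by
    rw [ha, Real.sq_sqrt (by positivity)]
    ring
  subst hlam heta hca
  set w : ℝ → ℝ := fun s => (t₀ - s)⁻¹ with hw
  have hwpos : ∀ t < t₀, 0 < w t := fun t ht => inv_pos.2 (sub_pos.2 ht)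
  have hyw : ∀ t < t₀, y t = √(w t ^ 2 + a) := by
    intro t ht
    rw [hydef t ht, hw, one_div, ← inv_pow, ← neg_sub t₀ t, inv_neg, neg_sq]
  have hypos : ∀ t < t₀, 0 < y t := fun t ht => hyw t ht ▸ Real.sqrt_pos.2 (by positivity)
  have hysq : ∀ t < t₀, y t ^ 2 = w t ^ 2 + a := fun t ht => by
    rw [hyw t ht, Real.sq_sqrt (by positivity)]
  have hy' : ∀ t < t₀, HasDerivAt y (w t ^ 3 / y t) t := by
    intro t ht
    have h := hasDerivAt_sqrt_sq_add (a := a) (hasDerivAt_inv_const_sub ht) (by positivity)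
    refine (h.congr_of_eventuallyEq ?_).congr_deriv ?_
    · filter_upwards [Iio_mem_nhds ht] with s hs using hyw s hs
    · rw [hyw t ht]
      ring
  intro t ht
  have hy := hypos t ht
  have hwt := hwpos t ht
  have hrad := radicand_eq_sq hy.ne' (hysq t ht)
  have hsqrt : √((w t ^ 3 / y t) ^ 2) = w t ^ 3 / y t := Real.sqrt_sq (by positivity)
  have hradpos : 0 < (w t ^ 3 / y t) ^ 2 := by positivity
  have hy'' : deriv (deriv y) t = 3 * w t ^ 4 / y t - w t ^ 6 / y t ^ 3 := by
    have heq : deriv y =ᶠ[nhds t] fun s => w s ^ 3 / y s := by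
      filter_upwards [Iio_mem_nhds ht] with s hs using (hy' s hs).deriv
    have hd : HasDerivAt (fun s => w s ^ 3 / y s) _ t :=
      ((hasDerivAt_inv_const_sub ht).pow 3).div (hy' t ht) hy.ne'
    rw [heq.deriv_eq, hd.deriv]
    change (_ * w t ^ _ * w t ^ 2 * y t - w t ^ 3 * _) / _ = _
    field_simp
    push_cast
    ring
  refine ⟨hrad ▸ hradpos, ?_, ?_⟩
  · rw [hrad, hsqrt]
    exact hy' t ht
  · rw [hgdef _ (hrad ▸ hradpos), hrad, hsqrt, hy'', (hy' t ht).deriv,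
      div_mul_cancel₀ _ (by positivity)]
    have h := hysq t ht
    have h' : a = y t ^ 2 - w t ^ 2 := by linarith
    generalize y t = u at *
    generalize w t = v at *
    rw [h']
    field_simp
    ring
end

section
/- Let λ > 0, c ∈ ℝ, and η ∈ ℝ with c²/(16·λ²) − η/λ ≥ 0. Set A := √(c²/(16·λ²) − η/λ), B := c/(4·λ), and fix t₀ ∈ ℝ. Let I ⊆ ℝ be an open interval on which A·sin(2·√(2·λ)·(t − t₀)) + B > 0, and define y(t) := √(A·sin(2·√(2·λ)·(t − t₀)) + B) on I. Then y is twice differentiable on I and satisfies the undamped Ermakov–Painlevé II equation with ε = 0: y''(t) + 2·λ·y(t) − 2·η/y(t)³ = 0 for all t ∈ I. -/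
open Set

/-- The first two derivatives of `√u` near a point where `u` is positive. -/
theorem hasDerivAt_deriv_sqrt {u v : ℝ → ℝ} {w t : ℝ} (hu : ∀ s, HasDerivAt u (v s) s)
    (hv : HasDerivAt v w t) (ht : 0 < u t) :
    HasDerivAt (deriv fun s => Real.sqrt (u s))
      (w / (2 * Real.sqrt (u t)) - v t ^ 2 / (4 * Real.sqrt (u t) ^ 3)) t := by
  have hderiv : deriv (fun s => Real.sqrt (u s)) =ᶠ[nhds t]
      fun s => v s / (2 * Real.sqrt (u s)) := by
    filter_upwards [(hu t).continuousAt.eventually (lt_mem_nhds ht)] with s hs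
    exact ((hu s).sqrt hs.ne').deriv
  have hy : Real.sqrt (u t) ≠ 0 := (Real.sqrt_pos.2 ht).ne'
  refine HasDerivAt.congr_of_eventuallyEq ?_ hderiv
  refine (hv.div (((hu t).sqrt ht.ne').const_mul 2) (by positivity)).congr_deriv ?_
  field_simp
  ring

/-- For `λ > 0` and `A = √(c²/(16λ²) − η/λ)`, `B = c/(4λ)`, the function
`y(t) = √(A·sin(2√(2λ)(t − t₀)) + B)` is twice differentiable on any open interval where the
radicand is positive, and satisfies the undamped Ermakov–Painlevé II equation with `ε = 0`:
`y'' + 2λ·y − 2η/y³ = 0`. -/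
theorem explicit_solution_epII_eps_zero (lam c eta t₀ aI bI A B : ℝ)
    (hlam : 0 < lam)
    (hAB : 0 ≤ c ^ 2 / (16 * lam ^ 2) - eta / lam)
    (hA : A = Real.sqrt (c ^ 2 / (16 * lam ^ 2) - eta / lam))
    (hB : B = c / (4 * lam))
    (hpos : ∀ t ∈ Ioo aI bI,
      0 < A * Real.sin (2 * Real.sqrt (2 * lam) * (t - t₀)) + B) :
    ∀ t ∈ Ioo aI bI,
      DifferentiableAt ℝ
        (deriv (fun s => Real.sqrt (A * Real.sin (2 * Real.sqrt (2 * lam) * (s - t₀)) + B))) t ∧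
      deriv (deriv (fun s => Real.sqrt (A * Real.sin (2 * Real.sqrt (2 * lam) * (s - t₀)) + B))) t
        + 2 * lam * Real.sqrt (A * Real.sin (2 * Real.sqrt (2 * lam) * (t - t₀)) + B)
        - 2 * eta / (Real.sqrt (A * Real.sin (2 * Real.sqrt (2 * lam) * (t - t₀)) + B)) ^ 3
        = 0 := by
  intro t ht
  set ω := 2 * Real.sqrt (2 * lam) with hω
  have hω2 : ω ^ 2 = 8 * lam := by
    rw [hω, mul_pow, Real.sq_sqrt (by positivity)]
    ring
  clear_value ω
  have hA2 : lam * (B ^ 2 - A ^ 2) = eta := by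
    rw [hA, hB, Real.sq_sqrt hAB]
    field_simp
    ring
  have hθ : ∀ s, HasDerivAt (fun s => ω * (s - t₀)) ω s := fun s => by
    simpa using ((hasDerivAt_id s).sub_const t₀).const_mul ω
  have hu : ∀ s, HasDerivAt (fun s => A * Real.sin (ω * (s - t₀)) + B)
      (A * (Real.cos (ω * (s - t₀)) * ω)) s := fun s =>
    ((hθ s).sin.const_mul A).add_const B
  have hv : HasDerivAt (fun s => A * (Real.cos (ω * (s - t₀)) * ω))
      (A * (-Real.sin (ω * (t - t₀)) * ω * ω)) t :=
    ((hθ t).cos.mul_const ω).const_mul A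
  have hy := hasDerivAt_deriv_sqrt hu hv (hpos t ht)
  refine ⟨hy.differentiableAt, ?_⟩
  rw [hy.deriv]
  have hsq := Real.sq_sqrt (hpos t ht).le
  have hy0 := (Real.sqrt_pos.2 (hpos t ht)).ne'
  have hcos := Real.sin_sq_add_cos_sq (ω * (t - t₀))
  set y := Real.sqrt (A * Real.sin (ω * (t - t₀)) + B)
  set S := Real.sin (ω * (t - t₀))
  set C := Real.cos (ω * (t - t₀))
  have key : 2 * y ^ 2 * (A * (-S * ω * ω)) - (A * (C * ω)) ^ 2
      + 8 * lam * y ^ 4 - 8 * eta = 0 := by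
    have hy4 : y ^ 4 = (A * S + B) ^ 2 := by rw [← hsq]; ring
    rw [hy4, hsq]
    linear_combination (-2 * (A * S + B) * A * S - A ^ 2 * C ^ 2) * hω2
      - 8 * lam * A ^ 2 * hcos + 8 * hA2
  field_simp
  linear_combination 2 * key
end

section
/- Let λ > 0, c ∈ ℝ, η ∈ ℝ with c²/(16·λ²) − η/λ ≥ 0, A := √(c²/(16·λ²) − η/λ), B := c/(4·λ), t₀ ∈ ℝ, and define y(t) := √(A·sin(2·√(2·λ)·(t − t₀)) + B) on an open interval I on which A·sin(2·√(2·λ)·(t − t₀)) + B > 0. Then for all t ∈ I, (y'(t))² = c − 2·λ·y(t)² − 2·η/y(t)², i.e. y satisfies the first integral of the Chiellini-reduced Ermakov–Painlevé II equation with ε = 0. -/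
open Set

/-- For `λ > 0`, `A = √(c²/(16λ²) − η/λ)`, `B = c/(4λ)`, the function
`y(t) = √(A·sin(2√(2λ)(t − t₀)) + B)` satisfies the first integral
`(y')² = c − 2λ·y² − 2η/y²` on any open interval where the radicand is positive. -/
theorem explicit_solution_first_integral_eps_zero (lam c eta t₀ aI bI A B : ℝ)
    (hlam : 0 < lam)
    (hAB : 0 ≤ c ^ 2 / (16 * lam ^ 2) - eta / lam)
    (hA : A = Real.sqrt (c ^ 2 / (16 * lam ^ 2) - eta / lam))
    (hB : B = c / (4 * lam))
    (hpos : ∀ t ∈ Ioo aI bI,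
      0 < A * Real.sin (2 * Real.sqrt (2 * lam) * (t - t₀)) + B) :
    ∀ t ∈ Ioo aI bI,
      (deriv (fun s => Real.sqrt (A * Real.sin (2 * Real.sqrt (2 * lam) * (s - t₀)) + B)) t) ^ 2
        = c - 2 * lam * (Real.sqrt (A * Real.sin (2 * Real.sqrt (2 * lam) * (t - t₀)) + B)) ^ 2
          - 2 * eta / (Real.sqrt (A * Real.sin (2 * Real.sqrt (2 * lam) * (t - t₀)) + B)) ^ 2 := by
  intro t ht
  have hu := hpos t ht
  have hA2 : A ^ 2 = c ^ 2 / (16 * lam ^ 2) - eta / lam := by rw [hA, Real.sq_sqrt hAB]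
  have hc : c = 4 * lam * B := by rw [hB]; field_simp
  have heta : eta = lam * (B ^ 2 - A ^ 2) := by rw [hA2, hB]; field_simp; ring
  have hw : Real.sqrt (2 * lam) ^ 2 = 2 * lam := Real.sq_sqrt (by positivity)
  have hlin : HasDerivAt (fun s : ℝ => 2 * Real.sqrt (2 * lam) * (s - t₀))
      (2 * Real.sqrt (2 * lam) * 1) t :=
    ((hasDerivAt_id t).sub_const t₀).const_mul _
  have hderiv := (((hlin.sin).const_mul A).add_const B).sqrt hu.ne'
  rw [hderiv.deriv, div_pow, mul_pow 2 (Real.sqrt _), Real.sq_sqrt hu.le]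
  have htrig := Real.sin_sq_add_cos_sq (2 * Real.sqrt (2 * lam) * (t - t₀))
  have hu' := hu.ne'
  clear hA hB hA2 hAB hpos hlin hderiv
  generalize Real.sin (2 * Real.sqrt (2 * lam) * (t - t₀)) = x at *
  generalize Real.cos (2 * Real.sqrt (2 * lam) * (t - t₀)) = y at *
  generalize Real.sqrt (2 * lam) = w at *
  subst hc heta
  field_simp
  linear_combination A ^ 2 * y ^ 2 * hw + 2 * lam * A ^ 2 * htrig
end

section
/- Let δ, c ∈ ℝ and let J ⊆ (0,∞) be an open interval on which c·y⁴ − δ > 0. Define g(y) := −δ/(y³·√(c·y⁴ − δ)) on J. Let I ⊆ ℝ be an open interval and Y : I → J differentiable with Y'(t) = √(c − δ·Y(t)⁻⁴) for all t ∈ I. Then Y is twice differentiable and satisfies Y''(t) + g(Y(t))·Y'(t) − δ/Y(t)⁵ = 0 for all t ∈ I. -/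
open Set

/-- A solution of `Y' = √(c − δ·Y⁻⁴)` with values in an open interval
`J ⊆ (0,∞)` on which `c·y⁴ − δ > 0`, with `g(y) = −δ/(y³·√(c·y⁴ − δ))`, is twice
differentiable and satisfies the dissipative quintic Milne–Pinney-type equation
`Y'' + g(Y)·Y' − δ/Y⁵ = 0`. -/
theorem dissipative_quintic_milne_pinney (dlt c aJ bJ aI bI : ℝ) (g Y : ℝ → ℝ)
    (hJpos : ∀ y ∈ Ioo aJ bJ, 0 < y)
    (hJ : ∀ y ∈ Ioo aJ bJ, 0 < c * y ^ 4 - dlt)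
    (hgdef : ∀ y ∈ Ioo aJ bJ, g y = -dlt / (y ^ 3 * Real.sqrt (c * y ^ 4 - dlt)))
    (hYmem : ∀ t ∈ Ioo aI bI, Y t ∈ Ioo aJ bJ)
    (hY : ∀ t ∈ Ioo aI bI, HasDerivAt Y (Real.sqrt (c - dlt / (Y t) ^ 4)) t) :
    ∀ t ∈ Ioo aI bI,
      DifferentiableAt ℝ (deriv Y) t ∧
      deriv (deriv Y) t + g (Y t) * deriv Y t - dlt / (Y t) ^ 5 = 0 := by
  intro t ht
  have hy := hJpos _ (hYmem t ht)
  have hrad : 0 < c - dlt / (Y t) ^ 4 := by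
    have h := div_pos (hJ _ (hYmem t ht)) (pow_pos hy 4)
    rwa [sub_div, mul_div_cancel_right₀ _ (pow_pos hy 4).ne'] at h
  have hsqrt : √(c * Y t ^ 4 - dlt) = Y t ^ 2 * √(c - dlt / Y t ^ 4) := by
    have h : c * Y t ^ 4 - dlt = (Y t ^ 2) ^ 2 * (c - dlt / Y t ^ 4) := by
      field_simp
    rw [h, Real.sqrt_mul (by positivity), Real.sqrt_sq (by positivity)]
  have hS := Real.sqrt_pos.2 hrad
  have hderiv : deriv Y =ᶠ[nhds t] fun s => √(c - dlt / Y s ^ 4) := by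
    filter_upwards [isOpen_Ioo.mem_nhds ht] with s hs using (hY s hs).deriv
  have hsecond : HasDerivAt (deriv Y) (2 * dlt / Y t ^ 5) t := by
    have h := ((((hasDerivAt_const t dlt).fun_div ((hY t ht).fun_pow 4)
      (pow_pos hy 4).ne').const_sub c).sqrt hrad.ne').congr_of_eventuallyEq hderiv
    refine h.congr_deriv ?_
    generalize √(c - dlt / Y t ^ 4) = S at hS ⊢
    push_cast
    field_simp
    ring
  refine ⟨hsecond.differentiableAt, ?_⟩
  rw [hsecond.deriv, (hY t ht).deriv, hgdef _ (hYmem t ht), hsqrt]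
  generalize √(c - dlt / Y t ^ 4) = S at hS ⊢
  field_simp
  ring
end

section
/- Let λ, δ₀, k₁, k₂, c ∈ ℝ and let J ⊆ (0,∞) be an open interval on which P(y) := 2·(δ₀ − λ)·y² + c − 4·k₂/y − 2·k₁/y² > 0. Define g(y) := ((λ − δ₀)·y − k₂/y² − k₁/y³)/√(P(y)) on J. Let I ⊆ ℝ be an open interval and Y : I → J differentiable with Y'(t) = √(P(Y(t))) for all t ∈ I. Then Y is twice differentiable and satisfies the generalized damped Milne–Pinney equation Y''(t) + g(Y(t))·Y'(t) + λ·Y(t) = k₁/Y(t)³ + k₂/Y(t)² + δ₀·Y(t) for all t ∈ I. -/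
open Set

/-- Along an orbit of the autonomous equation `Y' = √(P(Y))` with `P` positive, the second
derivative of `Y` is `P'(Y) / 2`. -/
theorem hasDerivAt_deriv_of_eventually_hasDerivAt_sqrt {P Y : ℝ → ℝ} {p t : ℝ}
    (hP : HasDerivAt P p (Y t)) (hpos : 0 < P (Y t))
    (hY : ∀ᶠ s in nhds t, HasDerivAt Y (Real.sqrt (P (Y s))) s) :
    HasDerivAt (deriv Y) (p / 2) t := by
  have hsqrt : HasDerivAt (fun s => Real.sqrt (P (Y s))) (p / 2) t := by
    refine ((hP.comp t hY.self_of_nhds).sqrt hpos.ne').congr_deriv ?_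
    have : Real.sqrt (P (Y t)) ≠ 0 := (Real.sqrt_pos.2 hpos).ne'
    change p * Real.sqrt (P (Y t)) / (2 * Real.sqrt (P (Y t))) = p / 2
    field_simp
  exact hsqrt.congr_of_eventuallyEq (hY.mono fun s hs => hs.deriv)

theorem hasDerivAt_pinney_radicand (a c k₁ k₂ : ℝ) {y : ℝ} (hy : y ≠ 0) :
    HasDerivAt (fun y : ℝ => 2 * a * y ^ 2 + c - 4 * k₂ / y - 2 * k₁ / y ^ 2)
      (4 * a * y + 4 * k₂ / y ^ 2 + 4 * k₁ / y ^ 3) y := by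
  have hsq := hasDerivAt_pow 2 y
  refine ((((hsq.const_mul (2 * a)).add_const c).sub
    ((hasDerivAt_const y (4 * k₂)).div (hasDerivAt_id y) hy)).sub
    ((hasDerivAt_const y (2 * k₁)).div hsq (pow_ne_zero 2 hy))).congr_deriv ?_
  norm_num
  field_simp
  ring

/-- With `P(y) = 2(δ₀ − λ)y² + c − 4k₂/y − 2k₁/y²` positive on an open
interval `J ⊆ (0,∞)` and `g(y) = ((λ − δ₀)y − k₂/y² − k₁/y³)/√(P(y))`, any solution of
`Y' = √(P(Y))` with values in `J` is twice differentiable and satisfies the generalized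
damped Milne–Pinney equation `Y'' + g(Y)·Y' + λY = k₁/Y³ + k₂/Y² + δ₀·Y`. -/
theorem generalized_damped_milne_pinney_R_zero
    (lam dlt0 k₁ k₂ c aJ bJ aI bI : ℝ) (g Y : ℝ → ℝ)
    (hJpos : ∀ y ∈ Ioo aJ bJ, 0 < y)
    (hP : ∀ y ∈ Ioo aJ bJ,
      0 < 2 * (dlt0 - lam) * y ^ 2 + c - 4 * k₂ / y - 2 * k₁ / y ^ 2)
    (hgdef : ∀ y ∈ Ioo aJ bJ, g y =
      ((lam - dlt0) * y - k₂ / y ^ 2 - k₁ / y ^ 3) /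
        Real.sqrt (2 * (dlt0 - lam) * y ^ 2 + c - 4 * k₂ / y - 2 * k₁ / y ^ 2))
    (hYmem : ∀ t ∈ Ioo aI bI, Y t ∈ Ioo aJ bJ)
    (hY : ∀ t ∈ Ioo aI bI, HasDerivAt Y
      (Real.sqrt (2 * (dlt0 - lam) * (Y t) ^ 2 + c - 4 * k₂ / Y t - 2 * k₁ / (Y t) ^ 2)) t) :
    ∀ t ∈ Ioo aI bI,
      DifferentiableAt ℝ (deriv Y) t ∧
      deriv (deriv Y) t + g (Y t) * deriv Y t + lam * Y t
        = k₁ / (Y t) ^ 3 + k₂ / (Y t) ^ 2 + dlt0 * Y t := by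
  intro t ht
  have hmem := hYmem t ht
  have hpos := hP _ hmem
  have hd := hasDerivAt_deriv_of_eventually_hasDerivAt_sqrt
    (hasDerivAt_pinney_radicand (dlt0 - lam) c k₁ k₂ (hJpos _ hmem).ne') hpos
    (Filter.Eventually.mono (isOpen_Ioo.mem_nhds ht) hY)
  refine ⟨hd.differentiableAt, ?_⟩
  rw [hd.deriv, hgdef _ hmem, (hY t ht).deriv, div_mul_cancel₀ _ (Real.sqrt_pos.2 hpos).ne']
  ring
end

section
/- Let I ⊆ ℝ be an open interval, ω : I → ℝ continuous, and let x₁, x₂ : I → ℝ be twice differentiable solutions of ẍ(t) + ω(t)²·x(t) = 0 on I whose Wronskian satisfies x₁(t)·x₂'(t) − x₂(t)·x₁'(t) = 1 for all t ∈ I. Let A, B, C, κ ∈ ℝ with A·C − B² = κ, and suppose u(t) := A·x₁(t)² + 2·B·x₁(t)·x₂(t) + C·x₂(t)² > 0 for all t ∈ I. Then y := √u is twice differentiable and satisfies the Milne–Ermakov–Pinney equation y''(t) + ω(t)²·y(t) = κ/y(t)³ on I. -/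
open Set

/-- The derivative of the square root of a positive quadratic form in two functions. -/
lemma hasDerivAt_sqrt_quadratic {A B C p q t : ℝ} {x₁ x₂ : ℝ → ℝ}
    (h₁ : HasDerivAt x₁ p t) (h₂ : HasDerivAt x₂ q t)
    (hu : 0 < A * (x₁ t) ^ 2 + 2 * B * x₁ t * x₂ t + C * (x₂ t) ^ 2) :
    HasDerivAt
      (fun s => √(A * (x₁ s) ^ 2 + 2 * B * x₁ s * x₂ s + C * (x₂ s) ^ 2))
      ((A * x₁ t * p + B * (p * x₂ t + x₁ t * q) + C * x₂ t * q) /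
        √(A * (x₁ t) ^ 2 + 2 * B * x₁ t * x₂ t + C * (x₂ t) ^ 2)) t := by
  have h := ((((h₁.fun_pow 2).const_mul A).fun_add ((h₁.const_mul (2 * B)).fun_mul h₂)).fun_add
    ((h₂.fun_pow 2).const_mul C)).sqrt hu.ne'
  refine h.congr_deriv ?_
  have hs := (Real.sqrt_pos.2 hu).ne'
  field_simp
  push_cast
  ring

/-- The derivative of the polarized form of a quadratic form in two functions. -/
lemma hasDerivAt_polarized_quadratic {A B C p' q' t : ℝ} {x₁ x₂ p q : ℝ → ℝ}
    (h₁ : HasDerivAt x₁ (p t) t) (h₂ : HasDerivAt x₂ (q t) t)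
    (hp : HasDerivAt p p' t) (hq : HasDerivAt q q' t) :
    HasDerivAt
      (fun s => A * x₁ s * p s + B * (p s * x₂ s + x₁ s * q s) + C * x₂ s * q s)
      (A * (p t) ^ 2 + 2 * B * p t * q t + C * (q t) ^ 2 +
        (A * x₁ t * p' + B * (p' * x₂ t + x₁ t * q') + C * x₂ t * q')) t := by
  have h := (((h₁.const_mul A).fun_mul hp).fun_add
    (((hp.fun_mul h₂).fun_add (h₁.fun_mul hq)).const_mul B)).fun_add
    ((h₂.const_mul C).fun_mul hq)
  exact h.congr_deriv (by ring)

/-- If `x₁, x₂` solve the time-dependent harmonic oscillator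
`ẍ + ω²(t)x = 0` with unit Wronskian, `A·C − B² = κ`, and
`u = A·x₁² + 2B·x₁·x₂ + C·x₂² > 0`, then `y = √u` solves the Milne–Ermakov–Pinney
equation `y'' + ω²(t)·y = κ/y³`. -/
theorem milne_ermakov_pinney_solution (a b A B C κ : ℝ) (ω x₁ x₂ y : ℝ → ℝ)
    (hω : ContinuousOn ω (Ioo a b))
    (hx₁d : ∀ t ∈ Ioo a b, DifferentiableAt ℝ x₁ t)
    (hx₁d2 : ∀ t ∈ Ioo a b, DifferentiableAt ℝ (deriv x₁) t)
    (hx₂d : ∀ t ∈ Ioo a b, DifferentiableAt ℝ x₂ t)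
    (hx₂d2 : ∀ t ∈ Ioo a b, DifferentiableAt ℝ (deriv x₂) t)
    (hode₁ : ∀ t ∈ Ioo a b, deriv (deriv x₁) t + (ω t) ^ 2 * x₁ t = 0)
    (hode₂ : ∀ t ∈ Ioo a b, deriv (deriv x₂) t + (ω t) ^ 2 * x₂ t = 0)
    (hwron : ∀ t ∈ Ioo a b, x₁ t * deriv x₂ t - x₂ t * deriv x₁ t = 1)
    (hκ : A * C - B ^ 2 = κ)
    (hu : ∀ t ∈ Ioo a b,
      0 < A * (x₁ t) ^ 2 + 2 * B * x₁ t * x₂ t + C * (x₂ t) ^ 2)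
    (hydef : ∀ t : ℝ, y t =
      Real.sqrt (A * (x₁ t) ^ 2 + 2 * B * x₁ t * x₂ t + C * (x₂ t) ^ 2)) :
    ∀ t ∈ Ioo a b,
      DifferentiableAt ℝ (deriv y) t ∧
      deriv (deriv y) t + (ω t) ^ 2 * y t = κ / (y t) ^ 3 := by
  have hy : ∀ t ∈ Ioo a b, HasDerivAt y
      ((A * x₁ t * deriv x₁ t + B * (deriv x₁ t * x₂ t + x₁ t * deriv x₂ t) +
        C * x₂ t * deriv x₂ t) / y t) t := by
    intro t ht
    have h := hasDerivAt_sqrt_quadratic (hx₁d t ht).hasDerivAt (hx₂d t ht).hasDerivAt (hu t ht)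
    rwa [← hydef t, ← funext hydef] at h
  intro t ht
  have hy_pos : 0 < y t := by
    rw [hydef]
    exact Real.sqrt_pos.2 (hu t ht)
  have hy_sq : y t ^ 2 = A * (x₁ t) ^ 2 + 2 * B * x₁ t * x₂ t + C * (x₂ t) ^ 2 := by
    rw [hydef]
    exact Real.sq_sqrt (hu t ht).le
  have hg := hasDerivAt_polarized_quadratic (A := A) (B := B) (C := C)
    (hx₁d t ht).hasDerivAt (hx₂d t ht).hasDerivAt
    (hx₁d2 t ht).hasDerivAt (hx₂d2 t ht).hasDerivAt
  have hd := (hg.fun_div (hy t ht) hy_pos.ne').congr_of_eventuallyEq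
    (Filter.eventually_of_mem (isOpen_Ioo.mem_nhds ht) fun s hs => (hy s hs).deriv)
  refine ⟨hd.differentiableAt, ?_⟩
  rw [hd.deriv, eq_neg_of_add_eq_zero_left (hode₁ t ht),
    eq_neg_of_add_eq_zero_left (hode₂ t ht)]
  have hW := hwron t ht
  generalize deriv x₁ t = p at *
  generalize deriv x₂ t = q at *
  generalize x₁ t = x at *
  generalize x₂ t = z at *
  generalize y t = r at *
  have hκW : κ = (A * C - B ^ 2) * (x * q - z * p) ^ 2 := by rw [hW, hκ]; ring
  rw [hκW]
  field_simp
  linear_combination (A * p ^ 2 + 2 * B * p * q + C * q ^ 2 + ω t ^ 2 * r ^ 2) * hy_sq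
end
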